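/- arXiv:2409.01182 — 3 statements merged into one kernel-verified Lean document; each statement's English description precedes it below -/
import Mathlib

section
/- Let S = {w ∈ ℂ : |Re w| < π/2} and F(w) = w + sin(w). Then F restricted to S is a holomorphic bijection from S onto the hairpin domain Ω^H = {y ∈ ℝ² : |y₁| < π/2 + cosh(y₂)} with F′(w) = 1 + cos(w) ≠ 0 on S, and the function ψ^H : Ω^H → ℝ defined by ψ^H(F(w)) = Re(cos(w)) satisfies: ψ^H is harmonic and strictly positive in Ω^H; ψ^H extends continuously to the closure of Ω^H with ψ^H = 0 on ∂Ω^H; and ∇ψ^H extends continuously to the closure with |∇ψ^H| = 1 at every point of ∂Ω^H. -/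
open Complex Metric Set

/-- Second partial derivatives Laplacian for functions on `ℂ ≃ ℝ²`. -/
noncomputable def lap (f : ℂ → ℝ) (z : ℂ) : ℝ :=
  fderiv ℝ (fun w => fderiv ℝ f w 1) z 1 +
    fderiv ℝ (fun w => fderiv ℝ f w Complex.I) z Complex.I

/-- The gradient of `f : ℂ → ℝ`, viewed as a complex number `(∂₁ f, ∂₂ f)`. -/
noncomputable def gradC (f : ℂ → ℝ) (z : ℂ) : ℂ :=
  (fderiv ℝ f z 1 : ℂ) + (fderiv ℝ f z Complex.I : ℂ) * Complex.I

/-- `f` is harmonic on `s`: twice continuously differentiable with vanishing Laplacian. -/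
def HarmonicOnSet (f : ℂ → ℝ) (s : Set ℂ) : Prop :=
  ContDiffOn ℝ 2 f s ∧ ∀ z ∈ s, lap f z = 0

/-- The vertical strip `S = {|Re w| < π/2}`. -/
def SStrip : Set ℂ := {w : ℂ | |w.re| < Real.pi / 2}

/-- The conformal map `F(w) = w + sin w`. -/
noncomputable def Fmap (w : ℂ) : ℂ := w + Complex.sin w

/-- The hairpin domain `Ω^H = {y : |y₁| < π/2 + cosh y₂}` of Hauswirth–Hélein–Pacard. -/
def OmegaH : Set ℂ := {z : ℂ | |z.re| < Real.pi / 2 + Real.cosh z.im}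

/-- The closed vertical strip `{|Re w| ≤ π/2}`. -/
def closedStrip : Set ℂ := {w : ℂ | |w.re| ≤ Real.pi / 2}

theorem SStrip_subset_closedStrip : SStrip ⊆ closedStrip := by
  intro w (hw : |w.re| < Real.pi / 2)
  exact hw.le

theorem re_cos_eq (w : ℂ) : (Complex.cos w).re = Real.cos w.re * Real.cosh w.im := by
  rw [Complex.cos_eq]
  simp [← Complex.ofReal_cos, ← Complex.ofReal_cosh, ← Complex.ofReal_sin, ← Complex.ofReal_sinh]

theorem im_cos_eq (w : ℂ) : (Complex.cos w).im = -(Real.sin w.re * Real.sinh w.im) := by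
  rw [Complex.cos_eq]
  simp [← Complex.ofReal_cos, ← Complex.ofReal_cosh, ← Complex.ofReal_sin, ← Complex.ofReal_sinh]

theorem re_sin_eq (w : ℂ) : (Complex.sin w).re = Real.sin w.re * Real.cosh w.im := by
  rw [Complex.sin_eq]
  simp [← Complex.ofReal_cos, ← Complex.ofReal_cosh, ← Complex.ofReal_sin, ← Complex.ofReal_sinh]

theorem im_sin_eq (w : ℂ) : (Complex.sin w).im = Real.cos w.re * Real.sinh w.im := by
  rw [Complex.sin_eq]
  simp [← Complex.ofReal_cos, ← Complex.ofReal_cosh, ← Complex.ofReal_sin, ← Complex.ofReal_sinh]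

theorem re_cos_nonneg {w : ℂ} (hw : w ∈ closedStrip) : 0 ≤ (Complex.cos w).re := by
  rw [re_cos_eq]
  exact mul_nonneg (Real.cos_nonneg_of_mem_Icc (abs_le.1 hw)) (Real.cosh_pos _).le

theorem re_cos_pos {w : ℂ} (hw : w ∈ SStrip) : 0 < (Complex.cos w).re := by
  rw [re_cos_eq]
  exact mul_pos (Real.cos_pos_of_mem_Ioo (abs_lt.1 hw)) (Real.cosh_pos _)

theorem one_add_cos_ne_zero {w : ℂ} (hw : w ∈ closedStrip) : 1 + Complex.cos w ≠ 0 := fun h => by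
  have h1 := re_cos_nonneg hw
  have h2 := congrArg Complex.re h
  simp only [Complex.add_re, Complex.one_re, Complex.zero_re] at h2
  linarith

theorem hasStrictDerivAt_Fmap (w : ℂ) : HasStrictDerivAt Fmap (1 + Complex.cos w) w :=
  (hasStrictDerivAt_id w).add (Complex.hasStrictDerivAt_sin w)

theorem continuous_Fmap : Continuous Fmap := continuous_id.add Complex.continuous_sin

theorem convex_closedStrip : Convex ℝ closedStrip := by
  have : closedStrip = Complex.reLm ⁻¹' Icc (-(Real.pi / 2)) (Real.pi / 2) := by
    ext w; simp [closedStrip, abs_le]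
  rw [this]
  exact (convex_Icc _ _).linear_preimage _

theorem isClosed_closedStrip : IsClosed closedStrip :=
  isClosed_le (continuous_abs.comp Complex.continuous_re) continuous_const

theorem isOpen_SStrip : IsOpen SStrip :=
  isOpen_lt (continuous_abs.comp Complex.continuous_re) continuous_const

theorem isOpen_OmegaH : IsOpen OmegaH :=
  isOpen_lt (continuous_abs.comp Complex.continuous_re)
    (continuous_const.add (Real.continuous_cosh.comp Complex.continuous_im))

/-- Since `Re F' ≥ 1`, the map `F` does not decrease distances on the closed strip. -/
theorem dist_le_dist_Fmap {w v : ℂ} (hw : w ∈ closedStrip) (hv : v ∈ closedStrip) :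
    dist w v ≤ dist (Fmap w) (Fmap v) := by
  set d := v - w with hd
  have hderiv (t : ℝ) : HasDerivAt (fun t : ℝ => (starRingEnd ℂ d * Complex.sin (w + t * d)).re)
      ((starRingEnd ℂ d * (Complex.cos (w + t * d) * d)).re) t := by
    have h1 : HasDerivAt (fun s : ℂ => starRingEnd ℂ d * Complex.sin (w + s * d))
        (starRingEnd ℂ d * (Complex.cos (w + t * d) * d)) (t : ℂ) := by
      refine HasDerivAt.const_mul _ ?_
      have := (((hasDerivAt_id (t : ℂ)).mul_const d).const_add w).csin
      simpa using this
    exact h1.real_of_complex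
  have hmono : MonotoneOn (fun t : ℝ => (starRingEnd ℂ d * Complex.sin (w + t * d)).re)
      (Icc 0 1) := by
    refine monotoneOn_of_deriv_nonneg (convex_Icc 0 1)
      (fun t _ => (hderiv t).continuousAt.continuousWithinAt)
      (fun t _ => (hderiv t).differentiableAt.differentiableWithinAt) fun t ht => ?_
    rw [(hderiv t).deriv]
    have hmem : w + t * d ∈ closedStrip := by
      have := convex_closedStrip.add_smul_sub_mem hw hv (interior_subset ht)
      simpa [hd] using this
    have := re_cos_nonneg hmem
    have heq : starRingEnd ℂ d * (Complex.cos (w + t * d) * d)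
        = (Complex.normSq d : ℂ) * Complex.cos (w + t * d) := by
      rw [Complex.normSq_eq_conj_mul_self]; ring
    rw [heq, Complex.re_ofReal_mul]
    exact mul_nonneg (Complex.normSq_nonneg _) this
  have h01 := hmono (left_mem_Icc.2 zero_le_one) (right_mem_Icc.2 zero_le_one) zero_le_one
  have hwv : w + d = v := by rw [hd]; ring
  simp only [Complex.ofReal_zero, zero_mul, add_zero, Complex.ofReal_one, one_mul, hwv] at h01
  have hle : ‖d‖ * ‖d‖ ≤ ‖d‖ * ‖Fmap v - Fmap w‖ := by
    have h2 : (starRingEnd ℂ d * (Fmap v - Fmap w)).re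
        = ‖d‖ * ‖d‖ + ((starRingEnd ℂ d * Complex.sin v).re
          - (starRingEnd ℂ d * Complex.sin w).re) := by
      have : starRingEnd ℂ d * (Fmap v - Fmap w) = (Complex.normSq d : ℂ)
          + (starRingEnd ℂ d * Complex.sin v - starRingEnd ℂ d * Complex.sin w) := by
        rw [Complex.normSq_eq_conj_mul_self]; simp only [Fmap, hd]; ring
      rw [this, Complex.add_re, Complex.ofReal_re, Complex.normSq_eq_norm_sq, Complex.sub_re, sq]
    have h3 := Complex.re_le_norm (starRingEnd ℂ d * (Fmap v - Fmap w))
    rw [norm_mul, Complex.norm_conj] at h3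
    linarith
  rw [dist_comm w, dist_comm (Fmap w), dist_eq_norm, dist_eq_norm, ← hd]
  rcases (norm_nonneg d).eq_or_lt with h | h
  · rw [← h]; exact norm_nonneg _
  · exact le_of_mul_le_mul_left hle h

theorem injOn_Fmap : InjOn Fmap closedStrip := fun w hw v hv h => by
  have := dist_le_dist_Fmap hw hv
  rw [h, dist_self] at this
  exact dist_le_zero.1 this

theorem isClosed_image_Fmap : IsClosed (Fmap '' closedStrip) := by
  refine IsSeqClosed.isClosed fun z a hz ha => ?_
  choose w hw hwz using hz
  have hcauchy : CauchySeq w := by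
    refine Metric.cauchySeq_iff.2 fun ε hε => ?_
    obtain ⟨N, hN⟩ := Metric.cauchySeq_iff.1 ha.cauchySeq ε hε
    refine ⟨N, fun m hm n hn => (dist_le_dist_Fmap (hw m) (hw n)).trans_lt ?_⟩
    rw [hwz, hwz]
    exact hN m hm n hn
  obtain ⟨b, hb⟩ := cauchySeq_tendsto_of_complete hcauchy
  have hFb := (continuous_Fmap.tendsto b).comp hb
  rw [show Fmap ∘ w = z from funext hwz] at hFb
  exact ⟨b, isClosed_closedStrip.mem_of_tendsto hb (.of_forall hw), tendsto_nhds_unique hFb ha⟩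

theorem isOpen_image_Fmap : IsOpen (Fmap '' SStrip) := by
  rw [isOpen_iff_mem_nhds]
  rintro _ ⟨w, hw, rfl⟩
  rw [← (hasStrictDerivAt_Fmap w).map_nhds_eq
    (one_add_cos_ne_zero (SStrip_subset_closedStrip hw))]
  exact Filter.image_mem_map (isOpen_SStrip.mem_nhds hw)

theorem mapsTo_Fmap : MapsTo Fmap SStrip OmegaH := fun w hw => by
  have hc : 0 < Real.cos w.re := Real.cos_pos_of_mem_Ioo (abs_lt.1 hw)
  have him : |w.im| ≤ |w.im + Real.cos w.re * Real.sinh w.im| := by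
    rcases le_total 0 w.im with h | h
    · have := mul_nonneg hc.le (Real.sinh_nonneg_iff.2 h)
      rw [abs_of_nonneg h]
      exact le_trans (by linarith) (le_abs_self _)
    · have := mul_nonpos_of_nonneg_of_nonpos hc.le (Real.sinh_nonpos_iff.2 h)
      rw [abs_of_nonpos h]
      exact le_trans (by linarith) (neg_le_abs _)
  have hcosh := Real.cosh_le_cosh.2 him
  have hs : |Real.sin w.re * Real.cosh w.im| ≤ Real.cosh w.im := by
    rw [abs_mul, abs_of_pos (Real.cosh_pos _)]
    exact mul_le_of_le_one_left (Real.cosh_pos _).le (Real.abs_sin_le_one _)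
  have hw' : |w.re| < Real.pi / 2 := hw
  simp only [OmegaH, mem_ofPred_eq, Fmap, Complex.add_re, Complex.add_im, re_sin_eq, im_sin_eq]
  linarith [abs_add_le w.re (Real.sin w.re * Real.cosh w.im)]

theorem re_eq_of_notMem_SStrip {w : ℂ} (hw : w ∈ closedStrip) (hw' : w ∉ SStrip) :
    w.re = Real.pi / 2 ∨ w.re = -(Real.pi / 2) := by
  have h : |w.re| = Real.pi / 2 := le_antisymm hw (not_lt.1 hw')
  exact (abs_eq (by positivity)).1 h

theorem Fmap_notMem_OmegaH {w : ℂ} (hw : w ∈ closedStrip) (hw' : w ∉ SStrip) :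
    Fmap w ∉ OmegaH := by
  have hp := Real.pi_pos
  have hcosh := Real.cosh_pos w.im
  simp only [OmegaH, mem_ofPred_eq, Fmap, Complex.add_re, Complex.add_im, re_sin_eq, im_sin_eq,
    not_lt]
  rcases re_eq_of_notMem_SStrip hw hw' with h | h <;> rw [h]
  · simp only [Real.cos_pi_div_two, Real.sin_pi_div_two, zero_mul, add_zero, one_mul]
    exact le_abs_self _
  · simp only [Real.cos_neg, Real.sin_neg, Real.cos_pi_div_two, Real.sin_pi_div_two, zero_mul,
      add_zero]
    exact le_trans (by linarith) (neg_le_abs _)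

theorem isPreconnected_OmegaH : IsPreconnected OmegaH := by
  have hpos (s : ℝ) : 0 < Real.pi / 2 + Real.cosh s := by
    have := Real.cosh_pos s; positivity
  have : OmegaH = (fun p : ℝ × ℝ => (⟨p.2 * (Real.pi / 2 + Real.cosh p.1), p.1⟩ : ℂ)) ''
      (univ ×ˢ Ioo (-1) 1) := by
    ext z
    simp only [OmegaH, mem_ofPred_eq, mem_image, mem_prod, mem_univ, true_and, Prod.exists]
    constructor
    · intro h
      refine ⟨z.im, z.re / (Real.pi / 2 + Real.cosh z.im), ?_, ?_⟩
      · rw [mem_Ioo, ← abs_lt, abs_div, abs_of_pos (hpos _), div_lt_one (hpos _)]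
        exact h
      · rw [div_mul_cancel₀ _ (hpos _).ne']
    · rintro ⟨s, t, ht, rfl⟩
      simp only [abs_mul, abs_of_pos (hpos s)]
      exact mul_lt_of_lt_one_left (hpos s) (abs_lt.2 ht)
  rw [this]
  refine (isPreconnected_univ.prod isPreconnected_Ioo).image _ (Continuous.continuousOn ?_)
  have : (fun p : ℝ × ℝ => (⟨p.2 * (Real.pi / 2 + Real.cosh p.1), p.1⟩ : ℂ))
      = fun p : ℝ × ℝ => ((p.2 * (Real.pi / 2 + Real.cosh p.1) : ℝ) : ℂ) + (p.1 : ℂ) * I := by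
    funext p
    exact Complex.mk_eq_add_mul_I _ _
  rw [this]
  fun_prop

theorem OmegaH_subset_image : OmegaH ⊆ Fmap '' SStrip := by
  have h0 : (0 : ℂ) ∈ SStrip := by simp [SStrip, Real.pi_pos]
  refine isPreconnected_OmegaH.subset_of_closure_inter_subset isOpen_image_Fmap
    ⟨Fmap 0, mapsTo_Fmap h0, mem_image_of_mem _ h0⟩ ?_
  rintro z ⟨hz, hzΩ⟩
  obtain ⟨w, hw, rfl⟩ :=
    closure_minimal (image_mono SStrip_subset_closedStrip) isClosed_image_Fmap hz
  by_contra h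
  exact Fmap_notMem_OmegaH hw (fun hwS => h (mem_image_of_mem _ hwS)) hzΩ

theorem bijOn_Fmap : BijOn Fmap SStrip OmegaH :=
  ⟨mapsTo_Fmap, injOn_Fmap.mono SStrip_subset_closedStrip, OmegaH_subset_image⟩

/-- The inverse of `F` on the closed strip. -/
noncomputable def FmapInv : ℂ → ℂ := Function.invFunOn Fmap closedStrip

theorem closure_OmegaH_subset : closure OmegaH ⊆ Fmap '' closedStrip :=
  closure_minimal (OmegaH_subset_image.trans (image_mono SStrip_subset_closedStrip))
    isClosed_image_Fmap

theorem FmapInv_mem {z : ℂ} (hz : z ∈ closure OmegaH) : FmapInv z ∈ closedStrip :=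
  Function.invFunOn_mem (closure_OmegaH_subset hz)

theorem Fmap_FmapInv {z : ℂ} (hz : z ∈ closure OmegaH) : Fmap (FmapInv z) = z :=
  Function.invFunOn_eq (closure_OmegaH_subset hz)

theorem FmapInv_Fmap {w : ℂ} (hw : w ∈ closedStrip) : FmapInv (Fmap w) = w :=
  injOn_Fmap.leftInvOn_invFunOn hw

theorem FmapInv_mem_SStrip {z : ℂ} (hz : z ∈ OmegaH) : FmapInv z ∈ SStrip := by
  by_contra h
  have hz' := subset_closure hz
  exact Fmap_notMem_OmegaH (FmapInv_mem hz') h ((Fmap_FmapInv hz').symm ▸ hz)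

theorem FmapInv_notMem_SStrip {z : ℂ} (hz : z ∈ frontier OmegaH) : FmapInv z ∉ SStrip := by
  intro h
  rw [isOpen_OmegaH.frontier_eq] at hz
  exact hz.2 (Fmap_FmapInv hz.1 ▸ mapsTo_Fmap h)

theorem continuousOn_FmapInv : ContinuousOn FmapInv (closure OmegaH) := by
  have : LipschitzOnWith 1 FmapInv (closure OmegaH) := LipschitzOnWith.of_dist_le_mul
    fun x hx y hy => by
      have := dist_le_dist_Fmap (FmapInv_mem hx) (FmapInv_mem hy)
      rwa [Fmap_FmapInv hx, Fmap_FmapInv hy, ← one_mul (dist x y)] at this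
  exact this.continuousOn

theorem hasDerivAt_cos_FmapInv {z : ℂ} (hz : z ∈ OmegaH) :
    HasDerivAt (fun z => Complex.cos (FmapInv z))
      (-Complex.sin (FmapInv z) / (1 + Complex.cos (FmapInv z))) z := by
  have hnhds := isOpen_OmegaH.mem_nhds hz
  have h : HasDerivAt FmapInv (1 + Complex.cos (FmapInv z))⁻¹ z :=
    HasDerivAt.of_local_left_inverse
      (continuousOn_FmapInv.continuousAt (Filter.mem_of_superset hnhds subset_closure))
      (hasStrictDerivAt_Fmap _).hasDerivAt
      (one_add_cos_ne_zero (FmapInv_mem (subset_closure hz)))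
      (Filter.mem_of_superset hnhds fun y hy => Fmap_FmapInv (subset_closure hy))
  simpa [div_eq_mul_inv] using h.ccos

theorem fderiv_re_apply {h : ℂ → ℂ} {h' z : ℂ} (hh : HasDerivAt h h' z) (v : ℂ) :
    fderiv ℝ (fun z => (h z).re) z v = (h' * v).re := by
  have := Complex.reCLM.hasFDerivAt.comp z hh.complexToReal_fderiv
  rw [show (fun z => (h z).re) = Complex.reCLM ∘ h from rfl, this.fderiv]
  simp

theorem gradC_re {h : ℂ → ℂ} {h' z : ℂ} (hh : HasDerivAt h h' z) :
    gradC (fun z => (h z).re) z = starRingEnd ℂ h' := by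
  rw [gradC, fderiv_re_apply hh, fderiv_re_apply hh]
  apply Complex.ext <;> simp

theorem harmonicOnSet_re {h : ℂ → ℂ} {s : Set ℂ} (hs : IsOpen s) (hh : DifferentiableOn ℂ h s) :
    HarmonicOnSet (fun z => (h z).re) s := by
  refine ⟨Complex.reCLM.contDiff.comp_contDiffOn ((hh.contDiffOn hs).restrict_scalars ℝ),
    fun z hz => ?_⟩
  have hd : HasDerivAt (deriv h) (deriv (deriv h) z) z :=
    ((hh.deriv hs).differentiableAt (hs.mem_nhds hz)).hasDerivAt
  have key (v : ℂ) : fderiv ℝ (fun w => fderiv ℝ (fun z => (h z).re) w v) z v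
      = (deriv (deriv h) z * v * v).re := by
    have heq : (fun w => fderiv ℝ (fun z => (h z).re) w v)
        =ᶠ[nhds z] fun w => (deriv h w * v).re :=
      Filter.mem_of_superset (hs.mem_nhds hz) fun w hw =>
        fderiv_re_apply (hh.differentiableAt (hs.mem_nhds hw)).hasDerivAt v
    rw [heq.fderiv_eq, fderiv_re_apply (hd.mul_const v)]
  rw [lap, key, key, mul_assoc _ I I, Complex.I_mul_I]
  simp

theorem norm_sin_div_one_add_cos {w : ℂ} (hw : w ∈ closedStrip) (hw' : w ∉ SStrip) :
    ‖-Complex.sin w / (1 + Complex.cos w)‖ = 1 := by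
  have hne := one_add_cos_ne_zero hw
  have h : ‖Complex.sin w‖ ^ 2 = ‖1 + Complex.cos w‖ ^ 2 := by
    rw [← Complex.normSq_eq_norm_sq, ← Complex.normSq_eq_norm_sq, Complex.normSq_apply,
      Complex.normSq_apply, Complex.add_re, Complex.add_im, re_cos_eq, im_cos_eq, re_sin_eq,
      im_sin_eq]
    have := Real.cosh_sq w.im
    rcases re_eq_of_notMem_SStrip hw hw' with h | h <;> rw [h] <;> simp <;> linarith
  rw [norm_div, norm_neg, (sq_eq_sq₀ (norm_nonneg _) (norm_nonneg _)).1 h,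
    div_self (norm_ne_zero_iff.2 hne)]

/-- `F` maps `S` holomorphically and bijectively onto `Ω^H` with
nonvanishing derivative `1 + cos w`, and the stream function `ψ^H` defined by
`ψ^H(F(w)) = Re(cos w)` is harmonic and positive in `Ω^H`, extends continuously by `0`
to `∂Ω^H`, and its gradient extends continuously with unit length on `∂Ω^H`. -/
theorem statement5 :
    Set.BijOn Fmap SStrip OmegaH ∧
    DifferentiableOn ℂ Fmap SStrip ∧
    (∀ w ∈ SStrip, deriv Fmap w = 1 + Complex.cos w ∧ 1 + Complex.cos w ≠ 0) ∧
    ∃ ψH : ℂ → ℝ,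
      (∀ w ∈ SStrip, ψH (Fmap w) = (Complex.cos w).re) ∧
      HarmonicOnSet ψH OmegaH ∧
      (∀ z ∈ OmegaH, 0 < ψH z) ∧
      ContinuousOn ψH (closure OmegaH) ∧
      (∀ z ∈ frontier OmegaH, ψH z = 0) ∧
      ∃ G : ℂ → ℂ,
        ContinuousOn G (closure OmegaH) ∧
        (∀ z ∈ OmegaH, G z = gradC ψH z) ∧
        (∀ z ∈ frontier OmegaH, ‖G z‖ = 1) := by
  refine ⟨bijOn_Fmap, fun w _ =>
    (hasStrictDerivAt_Fmap w).hasDerivAt.differentiableAt.differentiableWithinAt,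
    fun w hw => ⟨(hasStrictDerivAt_Fmap w).hasDerivAt.deriv,
      one_add_cos_ne_zero (SStrip_subset_closedStrip hw)⟩,
    fun z => (Complex.cos (FmapInv z)).re,
    fun w hw => by
      simp only [FmapInv_Fmap (SStrip_subset_closedStrip hw)],
    harmonicOnSet_re isOpen_OmegaH fun z hz =>
      (hasDerivAt_cos_FmapInv hz).differentiableAt.differentiableWithinAt,
    fun z hz => re_cos_pos (FmapInv_mem_SStrip hz),
    Complex.continuous_re.comp_continuousOn
      (Complex.continuous_cos.comp_continuousOn continuousOn_FmapInv),
    fun z hz => ?_,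
    fun z => starRingEnd ℂ (-Complex.sin (FmapInv z) / (1 + Complex.cos (FmapInv z))),
    Complex.continuous_conj.comp_continuousOn
      ((Complex.continuous_sin.comp_continuousOn continuousOn_FmapInv).neg.div
        (continuousOn_const.add (Complex.continuous_cos.comp_continuousOn continuousOn_FmapInv))
        fun z hz => one_add_cos_ne_zero (FmapInv_mem hz)),
    fun z hz => (gradC_re (hasDerivAt_cos_FmapInv hz)).symm,
    fun z hz => ?_⟩
  · simp only [re_cos_eq]
    rcases re_eq_of_notMem_SStrip (FmapInv_mem (frontier_subset_closure hz))
      (FmapInv_notMem_SStrip hz) with h | h <;> simp [h]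
  · rw [Complex.norm_conj]
    exact norm_sin_div_one_add_cos (FmapInv_mem (frontier_subset_closure hz))
      (FmapInv_notMem_SStrip hz)
end

section
/- Let 0 < δ < π/2 and F(w) = w + sin(w). There is a constant C > 0 such that for every w = w₁ + i w₂ ∈ ℂ with w₁ ∈ [−π/2 − δ, π/2 + δ], w₂ ≥ 0, and |F(w)| ≥ 2, one has |w₂ − log(2|F(w)|)| ≤ C · log|F(w)| / |F(w)|. -/
open Complex

theorem abs_two_mul_norm_sin_sub_exp_le {w : ℂ} (hw : 0 ≤ w.im) :
    |2 * ‖Complex.sin w‖ - Real.exp w.im| ≤ 1 := by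
  have h1 : 2 * ‖Complex.sin w‖ = ‖Complex.exp (-w * I) - Complex.exp (w * I)‖ := by
    simp only [Complex.sin, norm_div, norm_mul, Complex.norm_I, Complex.norm_ofNat]
    ring
  have h2 : ‖Complex.exp (-w * I)‖ = Real.exp w.im := by
    simp [Complex.norm_exp]
  have h3 : ‖Complex.exp (w * I)‖ ≤ 1 := by
    simp [Complex.norm_exp, hw]
  have h4 := abs_norm_sub_norm_le (Complex.exp (-w * I) - Complex.exp (w * I))
    (Complex.exp (-w * I))
  rw [← h1, h2, sub_sub_cancel_left, norm_neg] at h4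
  exact h4.trans h3

theorem abs_two_mul_norm_Fmap_sub_exp_le {w : ℂ} (hre : |w.re| ≤ 4) (hw : 0 ≤ w.im) :
    |2 * ‖Fmap w‖ - Real.exp w.im| ≤ 9 + 2 * w.im := by
  have h1 := abs_le.1 (abs_two_mul_norm_sin_sub_exp_le hw)
  have h2 : ‖w‖ ≤ 4 + w.im := by
    have := Complex.norm_le_abs_re_add_abs_im w
    rw [abs_of_nonneg hw] at this
    linarith
  have h3 := abs_norm_sub_norm_le (Fmap w) (Complex.sin w)
  have h4 : Fmap w - Complex.sin w = w := by simp [Fmap]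
  rw [h4] at h3
  have h5 := abs_le.1 (h3.trans h2)
  exact abs_le.2 ⟨by linarith, by linarith⟩

theorem abs_sub_log_le_of_abs_sub_exp_le {y R : ℝ} (hy : 0 ≤ y) (hR : 2 ≤ R)
    (h : |2 * R - Real.exp y| ≤ 9 + 2 * y) :
    |y - Real.log (2 * R)| ≤ 162 * Real.log R / R := by
  obtain ⟨hl, hu⟩ := abs_le.1 h
  have hR0 : 0 < R := by linarith
  have he : 0 < Real.exp y := Real.exp_pos y
  have hlog2 : 0.69 < Real.log 2 := by linarith [Real.log_two_gt_d9]
  have hlogR : Real.log 2 ≤ Real.log R := Real.log_le_log (by norm_num) hR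
  have hy_le : y ≤ 6 * Real.log R := by
    have hsq : Real.exp y = Real.exp (y / 2) ^ 2 := by
      rw [sq, ← Real.exp_add, add_halves]
    have hquad : (y / 2 + 1) ^ 2 ≤ Real.exp y := by
      rw [hsq]
      gcongr
      exact Real.add_one_le_exp _
    have hexp : Real.exp y ≤ 2 ^ 5 * R := by nlinarith [sq_nonneg (y - 6)]
    have := (Real.le_log_iff_exp_le (by positivity)).2 hexp
    rw [Real.log_mul (by norm_num) hR0.ne', Real.log_pow] at this
    push_cast at this
    linarith
  have hR_le : R ≤ 6 * Real.exp y := by linarith [Real.add_one_le_exp y]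
  have hnum : 6 * (9 + 2 * y) ≤ 162 * Real.log R := by linarith
  have hbound : (9 + 2 * y) / Real.exp y ≤ 162 * Real.log R / R := by
    rw [div_le_div_iff₀ he hR0]
    calc (9 + 2 * y) * R ≤ (9 + 2 * y) * (6 * Real.exp y) := by gcongr
      _ = 6 * (9 + 2 * y) * Real.exp y := by ring
      _ ≤ 162 * Real.log R * Real.exp y := by gcongr
  have hbound' : (9 + 2 * y) / (2 * R) ≤ 162 * Real.log R / R := by
    rw [div_le_div_iff₀ (by positivity) hR0]
    nlinarith
  have hlog_div : Real.log (Real.exp y / (2 * R)) = y - Real.log (2 * R) := by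
    rw [Real.log_div he.ne' (by positivity), Real.log_exp]
  have hupper : y - Real.log (2 * R) ≤ (9 + 2 * y) / (2 * R) := by
    rw [← hlog_div]
    refine (Real.log_le_sub_one_of_pos (by positivity)).trans ?_
    rw [div_sub_one (by positivity)]
    gcongr
    linarith
  have hlower : -(y - Real.log (2 * R)) ≤ (9 + 2 * y) / Real.exp y := by
    rw [← hlog_div, ← Real.log_inv, inv_div]
    refine (Real.log_le_sub_one_of_pos (by positivity)).trans ?_
    rw [div_sub_one he.ne']
    gcongr
  exact abs_le'.2 ⟨hupper.trans hbound', hlower.trans hbound⟩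

/-- the relation `w₂ = log(2|F(w)|) + O(log|F(w)|/|F(w)|)` between the strip
coordinate `w = w₁ + i w₂` and the hairpin coordinate `z = F(w)`. -/
theorem statement8 (δ : ℝ) (hδ0 : 0 < δ) (hδ : δ < Real.pi / 2) :
    ∃ C : ℝ, 0 < C ∧
      ∀ w : ℂ, -(Real.pi / 2 + δ) ≤ w.re → w.re ≤ Real.pi / 2 + δ → 0 ≤ w.im →
        2 ≤ ‖Fmap w‖ →
        |w.im - Real.log (2 * ‖Fmap w‖)| ≤ C * Real.log ‖Fmap w‖ / ‖Fmap w‖ := by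
  refine ⟨162, by norm_num, fun w h1 h2 hw hF => ?_⟩
  have hre : |w.re| ≤ 4 :=
    abs_le.2 ⟨by linarith [Real.pi_le_four], by linarith [Real.pi_le_four]⟩
  exact abs_sub_log_le_of_abs_sub_exp_le hw hF (abs_two_mul_norm_Fmap_sub_exp_le hre hw)
end

section
/- Let S₀ = ℝ × (0, π) ⊆ ℝ², 0 < σ < 1, and 0 < α < 1. Suppose u is continuous on the closure of S₀, harmonic in S₀, satisfies |u(x₁,x₂)| ≤ e^{−σ|x₁|} for all (x₁,x₂) in the closure of S₀, and satisfies the boundary Hölder condition: for all x₁ ∈ ℝ, x₂ ∈ {0, π}, and x₁′, x₁″ ∈ [x₁ − 1, x₁ + 1], |u(x₁′, x₂) − u(x₁″, x₂)| ≤ e^{−σ|x₁|} |x₁′ − x₁″|^α. Then there is a constant C = C(σ, α) such that |∇u(x₁,x₂)| ≤ C · min(x₂, π − x₂)^{α−1} · e^{−σ|x₁|} for all (x₁,x₂) ∈ S₀. -/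
open Complex Set

/-- The horizontal strip `S₀ = ℝ × (0, π)`. -/
def S0 : Set ℂ := {z : ℂ | 0 < z.im ∧ z.im < Real.pi}

open Filter Topology Metric InnerProductSpace

/-- A function harmonic on an open set in the sense of `HarmonicOnSet` is harmonic there in the
sense of Mathlib. -/
lemma HarmonicOnSet.harmonicOnNhd {f : ℂ → ℝ} {s : Set ℂ} (hs : IsOpen s)
    (hf : HarmonicOnSet f s) : HarmonicOnNhd f s := by
  have hlap : ∀ w ∈ s, Laplacian.laplacian f w = 0 := by
    intro w hw
    have hd : DifferentiableAt ℝ (fderiv ℝ f) w :=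
      ((hf.1.contDiffAt (hs.mem_nhds hw)).fderiv_right (m := 1) (by norm_num)).differentiableAt
        (by norm_num)
    have happ : ∀ v : ℂ, fderiv ℝ (fun y => fderiv ℝ f y v) w v = fderiv ℝ (fderiv ℝ f) w v v := by
      intro v
      rw [fderiv_clm_apply hd (differentiableAt_const v)]
      simp
    have := hf.2 w hw
    rw [lap, happ, happ] at this
    simpa [laplacian_eq_iteratedFDeriv_complexPlane, iteratedFDeriv_two_apply] using this
  intro z hz
  refine ⟨hf.1.contDiffAt (hs.mem_nhds hz), ?_⟩
  filter_upwards [hs.mem_nhds hz] with w hw using hlap w hw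

/-- A real harmonic function is constant near each of its local maxima. -/
lemma HarmonicAt.eventually_eq_of_isLocalMax {v : ℂ → ℝ} {z : ℂ} (hv : HarmonicAt v z)
    (hmax : IsLocalMax v z) : ∀ᶠ w in 𝓝 z, v w = v z := by
  obtain ⟨ε, hε, hball⟩ := Metric.isOpen_iff.1 (isOpen_setOfPred_harmonicAt (f := v)) z hv
  obtain ⟨F, hF, hFv⟩ := HarmonicOnNhd.exists_analyticOnNhd_ball_re_eq fun _ hy => hball hy
  have hmem : ∀ᶠ w in 𝓝 z, w ∈ ball z ε := ball_mem_nhds z hε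
  have hz : (F z).re = v z := hFv (mem_ball_self hε)
  have hconst := Complex.norm_eventually_eq_of_isLocalMax (f := fun w => Complex.exp (F w)) (c := z)
    (hmem.mono fun w hw => (hF w hw).differentiableAt.cexp) (by
      filter_upwards [hmem, hmax] with w hw hle
      have hw' : (F w).re = v w := hFv hw
      simpa [Complex.norm_exp, hw', hz] using hle)
  filter_upwards [hmem, hconst] with w hw h
  have hw' : (F w).re = v w := hFv hw
  simpa [Complex.norm_exp, hw', hz] using h

/-- The weak maximum principle for harmonic functions on a bounded open set. -/
lemma HarmonicOnNhd.nonpos_of_frontier {v : ℂ → ℝ} {U : Set ℂ} (hU : IsOpen U)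
    (hb : Bornology.IsBounded U) (hv : HarmonicOnNhd v U) (hc : ContinuousOn v (closure U))
    (hfr : ∀ z ∈ frontier U, v z ≤ 0) {z : ℂ} (hz : z ∈ closure U) : v z ≤ 0 := by
  obtain ⟨m, hm, hmax⟩ := hb.isCompact_closure.exists_isMaxOn ⟨z, hz⟩ hc
  have hK : IsCompact (closure U ∩ v ⁻¹' {v m}) :=
    hb.isCompact_closure.of_isClosed_subset
      (hc.preimage_isClosed_of_isClosed isClosed_closure isClosed_singleton) inter_subset_left
  -- Among the maximum points, one with the largest real part cannot be interior.
  obtain ⟨p, ⟨hp, hpm⟩, hpmax⟩ := hK.exists_isMaxOn ⟨m, hm, rfl⟩ Complex.continuous_re.continuousOn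
  have hpm : v p = v m := hpm
  have hpU : p ∉ U := by
    intro hpU
    have hev := HarmonicAt.eventually_eq_of_isLocalMax (hv p hpU) (by
      filter_upwards [hU.mem_nhds hpU] with w hw
      exact hpm ▸ hmax (subset_closure hw))
    obtain ⟨ε, hε, hball⟩ := Metric.eventually_nhds_iff_ball.1 (hev.and (hU.mem_nhds hpU))
    obtain ⟨hq, hqU⟩ := hball (p + ((ε / 2 : ℝ) : ℂ)) (by
      rw [mem_ball, dist_eq_norm, add_sub_cancel_left, Complex.norm_real, Real.norm_eq_abs,
        abs_of_pos (by positivity)]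
      linarith)
    have hle : (p + ((ε / 2 : ℝ) : ℂ)).re ≤ p.re := hpmax ⟨subset_closure hqU, hq.trans hpm⟩
    rw [Complex.add_re, Complex.ofReal_re] at hle
    linarith
  have hpf : p ∈ frontier U := by
    rw [hU.frontier_eq]
    exact ⟨hp, hpU⟩
  exact (hmax hz).trans (hpm ▸ hfr p hpf)

/-- The interior gradient estimate for harmonic functions. -/
lemma HarmonicOnNhd.norm_gradC_le {u : ℂ → ℝ} {z : ℂ} {R M c : ℝ} (hR : 0 < R) (hM : 0 < M)
    (hu : HarmonicOnNhd u (ball z R)) (hb : ∀ w ∈ ball z R, |u w - c| ≤ M) :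
    ‖gradC u z‖ ≤ 8 * M / R := by
  obtain ⟨F, hF, hFu⟩ := hu.exists_analyticOnNhd_ball_re_eq
  have hz : z ∈ ball z R := mem_ball_self hR
  have hFz := (hF z hz).differentiableAt
  have hre : HasFDerivAt u
      (Complex.reCLM.comp ((fderiv ℂ F z).restrictScalars ℝ)) z := by
    refine HasFDerivAt.congr_of_eventuallyEq
      (Complex.reCLM.hasFDerivAt.comp z (hFz.hasFDerivAt.restrictScalars ℝ)) ?_
    filter_upwards [ball_mem_nhds z hR] with w hw using (hFu hw).symm
  have hI : fderiv ℂ F z Complex.I = Complex.I * deriv F z := by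
    rw [← fderiv_apply_one_eq_deriv, ← smul_eq_mul, ← map_smul]
    simp
  have hgrad : gradC u z = starRingEnd ℂ (deriv F z) := by
    rw [gradC, hre.fderiv]
    apply Complex.ext <;> simp [hI]
  have hmaps : MapsTo (fun w => z + w) (ball 0 R) (ball z R) := fun w hw => by
    simpa using hw
  set G : ℂ → ℂ := fun w => F (z + w) - F z with hG
  have hGd : DifferentiableOn ℂ G (ball 0 R) :=
    ((hF.differentiableOn.comp (by fun_prop) hmaps).sub_const _)
  have hGre : MapsTo G (ball 0 R) {w | w.re ≤ 2 * M} := by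
    intro w hw
    have h1 : (F (z + w)).re = u (z + w) := hFu (hmaps hw)
    have h2 : (F z).re = u z := hFu hz
    have h3 := abs_le.1 (hb _ (hmaps hw))
    have h4 := abs_le.1 (hb z hz)
    simp only [hG, mem_ofPred_eq, Complex.sub_re, h1, h2]
    linarith
  have hGderiv : deriv G 0 = deriv F z := by
    simp only [hG, deriv_sub_const]
    rw [deriv_comp_const_add]
    simp
  have hcauchy : ‖deriv G 0‖ ≤ (4 * M) / (R / 2) := by
    refine Complex.norm_deriv_le_of_forall_mem_sphere_norm_le (by positivity)
      ((hGd.mono (closedBall_subset_ball (by linarith))).diffContOnCl_ball subset_rfl) ?_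
    intro w hw
    have hw' : ‖w‖ = R / 2 := by simpa using hw
    have := Complex.borelCaratheodory_zero (M := 2 * M) (by positivity) hGd hGre hR
      (z := w) (by simp [hw']; linarith) (by simp [hG])
    refine this.trans (le_of_eq ?_)
    rw [hw']
    field_simp
    ring
  rw [hgrad, RCLike.norm_conj, ← hGderiv]
  refine hcauchy.trans (le_of_eq ?_)
  field_simp
  ring

/-- On the right half plane `Re (w ^ α)` is comparable to `‖w‖ ^ α`. -/
lemma cos_mul_norm_rpow_le_re_cpow {α : ℝ} (hα0 : 0 < α) (hα1 : α < 1) {w : ℂ} (hw : 0 ≤ w.re) :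
    Real.cos (Real.pi / 2 * α) * ‖w‖ ^ α ≤ (w ^ (α : ℂ)).re := by
  rw [Complex.cpow_ofReal_re, mul_comm]
  have harg := Complex.abs_arg_le_pi_div_two_iff.2 hw
  gcongr
  rw [← Real.cos_abs (w.arg * α), abs_mul, abs_of_pos hα0]
  exact Real.cos_le_cos_of_nonneg_of_le_pi (by positivity) (by nlinarith [Real.pi_pos])
    (by gcongr)

/-- A boundary Hölder estimate at a point `p` propagates to the interior of a domain lying on one
side of a line through `p`. -/
lemma HarmonicOnNhd.abs_sub_le_of_frontier {α : ℝ} (hα0 : 0 < α) (hα1 : α < 1) {u : ℂ → ℝ}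
    {U : Set ℂ} {p e : ℂ} {A c : ℝ} (hA : 0 ≤ A) (hU : IsOpen U) (hb : Bornology.IsBounded U)
    (he : ‖e‖ = 1) (hside : ∀ z ∈ U, 0 < (e * (z - p)).re)
    (hu : HarmonicOnNhd u U) (hc : ContinuousOn u (closure U))
    (hfr : ∀ z ∈ frontier U, |u z - c| ≤ A * ‖z - p‖ ^ α) {z : ℂ} (hz : z ∈ U) :
    |u z - c| ≤ A / Real.cos (Real.pi / 2 * α) * ‖z - p‖ ^ α := by
  set k := Real.cos (Real.pi / 2 * α) with hk
  have hkpos : 0 < k :=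
    Real.cos_pos_of_mem_Ioo ⟨by nlinarith [Real.pi_pos], by nlinarith [Real.pi_pos]⟩
  set h : ℂ → ℝ := fun z => ((e * (z - p)) ^ (α : ℂ)).re with hh
  have hsidecl : ∀ z ∈ closure U, 0 ≤ (e * (z - p)).re := fun z hz =>
    closure_minimal (fun w hw => (hside w hw).le)
      (isClosed_le continuous_const (Complex.continuous_re.comp (by fun_prop))) hz
  have hnorm : ∀ z, ‖e * (z - p)‖ = ‖z - p‖ := fun z => by rw [norm_mul, he, one_mul]
  have hlow : ∀ z ∈ closure U, k * ‖z - p‖ ^ α ≤ h z := fun z hz => by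
    simpa only [hnorm] using cos_mul_norm_rpow_le_re_cpow hα0 hα1 (hsidecl z hz)
  have hup : h z ≤ ‖z - p‖ ^ α := by
    refine (Complex.re_le_norm _).trans (le_of_eq ?_)
    rw [Complex.norm_cpow_real, hnorm]
  have hharm : HarmonicOnNhd h U := fun z hz =>
    (((analyticAt_const.mul (analyticAt_id.sub analyticAt_const)).cpow analyticAt_const
      (Or.inl (hside z hz)) : AnalyticAt ℂ (fun z => (e * (z - p)) ^ (α : ℂ)) z)).harmonicAt_re
  have hcont : ContinuousOn h (closure U) := fun z hz => by
    refine ContinuousAt.continuousWithinAt (Complex.continuous_re.continuousAt.comp ?_)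
    exact ContinuousAt.comp (f := fun z => e * (z - p)) (g := fun w : ℂ => w ^ (α : ℂ))
      (Complex.continuousAt_cpow_const_of_re_pos (Or.inl (hsidecl z hz)) (by simpa using hα0))
      (by fun_prop)
  have key : ∀ s : ℝ, |s| = 1 → s * (u z - c) ≤ A / k * ‖z - p‖ ^ α := by
    intro s hs
    have hv := HarmonicOnNhd.nonpos_of_frontier (v := s • (u - fun _ => c) - (A / k) • h) hU hb
      (((hu.sub (harmonicOnNhd_const c)).const_smul).sub hharm.const_smul)
      (((hc.sub continuousOn_const).const_smul s).sub (hcont.const_smul (A / k)))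
      (fun w hw => by
        have h1 := hfr w hw
        have h2 := hlow w (frontier_subset_closure hw)
        have h3 : s * (u w - c) ≤ |u w - c| := by
          simpa [abs_mul, hs] using le_abs_self (s * (u w - c))
        have h4 : A * ‖w - p‖ ^ α ≤ A / k * h w := by
          calc A * ‖w - p‖ ^ α = A / k * (k * ‖w - p‖ ^ α) := by field_simp
            _ ≤ A / k * h w := by gcongr
        simp only [Pi.sub_apply, Pi.smul_apply, smul_eq_mul]
        linarith) (subset_closure hz)
    simp only [Pi.sub_apply, Pi.smul_apply, smul_eq_mul] at hv
    have : A / k * h z ≤ A / k * ‖z - p‖ ^ α := by gcongr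
    linarith
  have h1 := key 1 (by simp)
  have h2 := key (-1) (by simp)
  exact abs_le.2 ⟨by linarith, by linarith⟩

lemma S0_eq_preimage : S0 = Complex.im ⁻¹' Ioo 0 Real.pi := rfl

lemma isOpen_S0 : IsOpen S0 := isOpen_Ioo.preimage Complex.continuous_im

lemma closure_S0 : closure S0 = Complex.im ⁻¹' Icc 0 Real.pi := by
  rw [S0_eq_preimage, Complex.closure_preimage_im, closure_Ioo Real.pi_ne_zero.symm]

/-- The weight `exp (-σ|x|)` varies by at most the factor `exp σ` over unit distances. -/
lemma exp_neg_mul_abs_le {σ x y : ℝ} (hσ : 0 < σ) (h : |x - y| ≤ 1) :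
    Real.exp (-σ * |x|) ≤ Real.exp σ * Real.exp (-σ * |y|) := by
  rw [← Real.exp_add]
  have := abs_sub_abs_le_abs_sub y x
  rw [abs_sub_comm] at this
  exact Real.exp_le_exp.2 (by nlinarith)

/-- The weighted Hölder estimate for `u` at boundary points of the strip. -/
lemma abs_sub_boundary_le {σ α : ℝ} (hσ0 : 0 < σ) (hα0 : 0 < α) (hα1 : α < 1) {u : ℂ → ℝ}
    (hc : ContinuousOn u (closure S0)) (hu : HarmonicOnNhd u S0)
    (hbd : ∀ z ∈ closure S0, |u z| ≤ Real.exp (-σ * |z.re|))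
    (hH : ∀ x₁ x₂ : ℝ, (x₂ = 0 ∨ x₂ = Real.pi) →
        ∀ x' ∈ Set.Icc (x₁ - 1) (x₁ + 1), ∀ x'' ∈ Set.Icc (x₁ - 1) (x₁ + 1),
          |u ((x' : ℂ) + (x₂ : ℂ) * Complex.I) - u ((x'' : ℂ) + (x₂ : ℂ) * Complex.I)| ≤
            Real.exp (-σ * |x₁|) * |x' - x''| ^ α)
    {p z : ℂ} (hp : p.im = 0 ∨ p.im = Real.pi) (hz : z ∈ S0) (hzp : |z.re - p.re| ≤ 1) :
    |u z - u p| ≤ 2 * Real.exp σ * Real.exp (-σ * |p.re|) / Real.cos (Real.pi / 2 * α) *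
      ‖z - p‖ ^ α := by
  set A := 2 * Real.exp σ * Real.exp (-σ * |p.re|) with hA
  have hApos : 0 < A := by positivity
  have hpcl : p ∈ closure S0 := by
    rw [closure_S0]
    rcases hp with hp | hp <;> simp [hp, Real.pi_pos.le]
  have hosc : ∀ w ∈ closure S0, |w.re - p.re| ≤ 1 → |u w - u p| ≤ A := by
    intro w hw hwp
    have h1 := (hbd w hw).trans (exp_neg_mul_abs_le hσ0 hwp)
    have h2 := (hbd p hpcl).trans (exp_neg_mul_abs_le hσ0 (x := p.re) (y := p.re) (by simp))
    have h3 := abs_sub (u w) (u p)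
    rw [hA]
    linarith
  have hkpos : 0 < Real.cos (Real.pi / 2 * α) :=
    Real.cos_pos_of_mem_Ioo ⟨by nlinarith [Real.pi_pos], by nlinarith [Real.pi_pos]⟩
  rcases lt_or_ge ‖z - p‖ 1 with hlt | hge
  · obtain ⟨e, he, hside⟩ : ∃ e : ℂ, ‖e‖ = 1 ∧ ∀ w ∈ S0, 0 < (e * (w - p)).re := by
      rcases hp with hp | hp
      · exact ⟨-Complex.I, by simp, fun w hw => by simpa [hp] using hw.1⟩
      · exact ⟨Complex.I, by simp, fun w hw => by simpa [hp] using hw.2⟩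
    refine HarmonicOnNhd.abs_sub_le_of_frontier (U := ball p 1 ∩ S0) hα0 hα1 hApos.le
      (isOpen_ball.inter isOpen_S0) (isBounded_ball.subset inter_subset_left) he
      (fun w hw => hside w hw.2) (hu.mono inter_subset_right)
      (hc.mono (closure_mono inter_subset_right)) ?_ ⟨mem_ball_iff_norm.2 hlt, hz⟩
    intro w hw
    rw [(isOpen_ball.inter isOpen_S0).frontier_eq] at hw
    have hwcl : w ∈ closure S0 := closure_mono inter_subset_right hw.1
    have hw1 : ‖w - p‖ ≤ 1 := mem_closedBall_iff_norm.1
      (closure_ball_subset_closedBall (closure_mono inter_subset_left hw.1))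
    have hre : |w.re - p.re| ≤ ‖w - p‖ := by
      simpa using Complex.abs_re_le_norm (w - p)
    have him : |w.im - p.im| ≤ ‖w - p‖ := by
      simpa using Complex.abs_im_le_norm (w - p)
    rcases hw1.lt_or_eq with hlt | heq
    · have hwS : w ∉ S0 := fun h => hw.2 ⟨mem_ball_iff_norm.2 hlt, h⟩
      have hwim : w.im = p.im := by
        rw [closure_S0] at hwcl
        obtain ⟨h0, h1⟩ := hwcl
        have him' := abs_lt.1 (him.trans_lt hlt)
        have hpi := Real.pi_gt_three
        by_contra hne
        refine hwS ⟨?_, ?_⟩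
        · refine lt_of_le_of_ne h0 fun h => ?_
          rcases hp with hp | hp
          · exact hne (by rw [← h, hp])
          · linarith
        · refine lt_of_le_of_ne h1 fun h => ?_
          rcases hp with hp | hp
          · linarith
          · exact hne (by rw [h, hp])
      have hre1 := abs_le.1 (hre.trans hw1)
      have hhol := hH p.re p.im hp w.re ⟨by linarith, by linarith⟩ p.re
        ⟨by linarith, by linarith⟩
      rw [← hwim, Complex.re_add_im, hwim, Complex.re_add_im] at hhol
      have hle : Real.exp (-σ * |p.re|) ≤ A := by
        have := Real.one_le_exp hσ0.le
        rw [hA]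
        exact le_mul_of_one_le_left (Real.exp_pos _).le (by linarith)
      exact hhol.trans (by gcongr)
    · rw [heq, Real.one_rpow, mul_one]
      exact hosc w hwcl (hre.trans hw1)
  · refine (hosc z (subset_closure hz) hzp).trans ?_
    have h1 : A ≤ A / Real.cos (Real.pi / 2 * α) :=
      le_div_self hApos.le hkpos (Real.cos_le_one _)
    exact h1.trans (le_mul_of_one_le_right (by positivity) (Real.one_le_rpow hge hα0.le))

/-- for `u` harmonic on `S₀ = ℝ × (0,π)`, continuous on the closure, with
`|u| ≤ e^{−σ|x₁|}` and a weighted boundary Hölder condition, the gradient satisfies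
`|∇u(x)| ≤ C(σ,α) min(x₂, π−x₂)^{α−1} e^{−σ|x₁|}` in `S₀`. -/
theorem statement11 (σ α : ℝ) (hσ0 : 0 < σ) (hσ1 : σ < 1) (hα0 : 0 < α) (hα1 : α < 1) :
    ∃ C : ℝ, ∀ u : ℂ → ℝ,
      ContinuousOn u (closure S0) →
      HarmonicOnSet u S0 →
      (∀ z ∈ closure S0, |u z| ≤ Real.exp (-σ * |z.re|)) →
      (∀ x₁ x₂ : ℝ, (x₂ = 0 ∨ x₂ = Real.pi) →
        ∀ x' ∈ Set.Icc (x₁ - 1) (x₁ + 1), ∀ x'' ∈ Set.Icc (x₁ - 1) (x₁ + 1),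
          |u ((x' : ℂ) + (x₂ : ℂ) * Complex.I) - u ((x'' : ℂ) + (x₂ : ℂ) * Complex.I)| ≤
            Real.exp (-σ * |x₁|) * |x' - x''| ^ α) →
      ∀ z ∈ S0,
        ‖gradC u z‖ ≤ C * min z.im (Real.pi - z.im) ^ (α - 1) * Real.exp (-σ * |z.re|) := by
  set k := Real.cos (Real.pi / 2 * α) with hk
  have hkpos : 0 < k :=
    Real.cos_pos_of_mem_Ioo ⟨by nlinarith [Real.pi_pos], by nlinarith [Real.pi_pos]⟩
  refine ⟨64 * Real.exp σ / k, fun u hc hharm hbd hH z hz => ?_⟩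
  have hu := hharm.harmonicOnNhd isOpen_S0
  set d := min z.im (Real.pi - z.im) with hd
  have hd0 : 0 < d := lt_min hz.1 (sub_pos.2 hz.2)
  have hd1 : d ≤ z.im := min_le_left _ _
  have hd2 : d ≤ Real.pi - z.im := min_le_right _ _
  have hpi := Real.pi_lt_four
  obtain ⟨p, hp, hpre, hdist⟩ :
      ∃ p : ℂ, (p.im = 0 ∨ p.im = Real.pi) ∧ p.re = z.re ∧ ‖z - p‖ = d := by
    rcases min_choice z.im (Real.pi - z.im) with h | h
    · refine ⟨⟨z.re, 0⟩, Or.inl rfl, rfl, ?_⟩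
      rw [Complex.norm_eq_sqrt_sq_add_sq, hd, h]
      simp [Real.sqrt_sq hz.1.le]
    · refine ⟨⟨z.re, Real.pi⟩, Or.inr rfl, rfl, ?_⟩
      rw [norm_sub_rev, Complex.norm_eq_sqrt_sq_add_sq, hd, h]
      simp [Real.sqrt_sq (sub_pos.2 hz.2).le]
  set B := 2 * Real.exp σ * Real.exp (-σ * |p.re|) / k with hB
  have hBpos : 0 < B := by positivity
  have hball : ∀ w ∈ ball z (d / 2), w ∈ S0 ∧ |u w - u p| ≤ B * (2 * d ^ α) := by
    intro w hw
    rw [mem_ball_iff_norm] at hw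
    have him : |w.im - z.im| < d / 2 := by
      simpa using (Complex.abs_im_le_norm (w - z)).trans_lt hw
    have hre : |w.re - p.re| < d / 2 := by
      simpa [hpre] using (Complex.abs_re_le_norm (w - z)).trans_lt hw
    have him' := abs_lt.1 him
    have hwS : w ∈ S0 := ⟨by linarith, by linarith⟩
    refine ⟨hwS, (abs_sub_boundary_le hσ0 hα0 hα1 hc hu hbd hH hp hwS (by linarith)).trans ?_⟩
    have hwp : ‖w - p‖ ≤ 2 * d := by
      have := norm_sub_le_norm_sub_add_norm_sub w z p
      linarith
    have h2 : (2 : ℝ) ^ α ≤ 2 :=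
      (Real.rpow_le_rpow_of_exponent_le one_le_two hα1.le).trans_eq (Real.rpow_one 2)
    have h3 : ‖w - p‖ ^ α ≤ 2 * d ^ α := by
      calc ‖w - p‖ ^ α ≤ (2 * d) ^ α := by gcongr
        _ = 2 ^ α * d ^ α := Real.mul_rpow (by norm_num) hd0.le
        _ ≤ 2 * d ^ α := by gcongr
    gcongr
  have hgrad := HarmonicOnNhd.norm_gradC_le (half_pos hd0) (by positivity : 0 < B * (2 * d ^ α))
    (hu.mono fun w hw => (hball w hw).1) (fun w hw => (hball w hw).2)
  refine hgrad.trans (le_of_eq ?_)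
  rw [hB, hpre, Real.rpow_sub_one hd0.ne']
  field_simp
  ring
end
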